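/- arXiv:2509.13121 — 3 statements merged into one kernel-verified Lean document; each statement's English description precedes it below -/
import Mathlib

section
/- In the space ℓ^∞(ℕ; ℝ) of bounded real sequences with the supremum norm, let e_i denote the standard unit vectors and let C₁ = {e_i : i ∈ ℕ}. Then diam(C₁) = 1, and for every integer k ≥ 1 one has Φ_k(C₁, 0) = 1/k; consequently P(C₁, 0) = 0. In particular, for every a ∈ ℝ^k with |a₁| + ⋯ + |a_k| = 1 and distinct indices i₁, …, i_k, one has ‖Σ_{j=1}^k a_j e_{i_j}‖_∞ = max_j |a_j| ≥ 1/k, with equality when all a_j = 1/k. -/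
/-- The finite-level diametral ℓ¹-pressure `Φ_k(C₁, x∞)`. -/
noncomputable def Phi {X : Type*} [NormedAddCommGroup X] [NormedSpace ℝ X]
    (C₁ : Set X) (xinf : X) (k : ℕ) : ℝ :=
  ⨆ y : Fin k → C₁, ⨅ a : {a : Fin k → ℝ // ∑ i, |a i| = 1},
    ‖∑ i, (a.1 i / Metric.diam C₁) • (((y i : X)) - xinf)‖

/-- The diametral ℓ¹-pressure `P(C₁, x∞) := inf over k ≥ 1 of Φ_k(C₁, x∞)`. -/
noncomputable def Pres {X : Type*} [NormedAddCommGroup X] [NormedSpace ℝ X]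
    (C₁ : Set X) (xinf : X) : ℝ :=
  ⨅ k : {k : ℕ // 1 ≤ k}, Phi C₁ xinf (k : ℕ)


/-- The standard unit vectors in `ℓ^∞(ℕ; ℝ)`. -/
noncomputable def einf (i : ℕ) : lp (fun _ : ℕ => ℝ) ⊤ := lp.single ⊤ i (1 : ℝ)

theorem einf_apply (i n : ℕ) : (einf i : ℕ → ℝ) n = if n = i then 1 else 0 := by
  unfold einf
  rw [lp.coeFn_single]
  simp [Pi.single_apply]

theorem comb_apply {k : ℕ} (a : Fin k → ℝ) (idx : Fin k → ℕ) (n : ℕ) :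
    ((∑ j, a j • einf (idx j) : lp (fun _ : ℕ => ℝ) ⊤) : ℕ → ℝ) n
      = ∑ j, if n = idx j then a j else 0 := by
  rw [lp.coeFn_sum, Finset.sum_apply]
  refine Finset.sum_congr rfl fun j _ => ?_
  rw [lp.coeFn_smul, Pi.smul_apply, einf_apply]
  simp

theorem comb_norm {k : ℕ} (hk : 1 ≤ k) (a : Fin k → ℝ) (idx : Fin k → ℕ)
    (h : Function.Injective idx) : ‖∑ j, a j • einf (idx j)‖ = ⨆ j, |a j| := by
  haveI : Nonempty (Fin k) := ⟨⟨0, hk⟩⟩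
  have hb : BddAbove (Set.range fun j => |a j|) := Set.finite_range _ |>.bddAbove
  have h0 : 0 ≤ ⨆ j, |a j| := Real.iSup_nonneg fun j => abs_nonneg _
  apply le_antisymm
  · refine lp.norm_le_of_forall_le h0 fun n => ?_
    rw [comb_apply]
    by_cases hn : ∃ j, n = idx j
    · obtain ⟨j, rfl⟩ := hn
      simp only [h.eq_iff, Finset.sum_ite_eq, Finset.mem_univ, if_true, Real.norm_eq_abs]
      exact le_ciSup hb j
    · push Not at hn
      simpa [hn] using h0
  · refine ciSup_le fun j => ?_
    have := lp.norm_apply_le_norm (p := ⊤) (by simp) (∑ j, a j • einf (idx j)) (idx j)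
    rw [comb_apply] at this
    simpa only [h.eq_iff, Finset.sum_ite_eq, Finset.mem_univ, if_true, Real.norm_eq_abs] using this

theorem sup_ge {k : ℕ} (hk : 1 ≤ k) (a : Fin k → ℝ) (ha : ∑ j, |a j| = 1) :
    1 / (k : ℝ) ≤ ⨆ j, |a j| := by
  have hb : BddAbove (Set.range fun j => |a j|) := Set.finite_range _ |>.bddAbove
  have h : ∑ j, |a j| ≤ ∑ _j : Fin k, ⨆ j, |a j| := Finset.sum_le_sum fun j _ => le_ciSup hb j
  rw [ha] at h
  have hk' : (0 : ℝ) < k := by exact_mod_cast hk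
  rw [div_le_iff₀ hk']
  simpa [mul_comm] using h

theorem unif_norm {k : ℕ} (hk : 1 ≤ k) (idx : Fin k → ℕ) (h : Function.Injective idx) :
    ‖∑ j : Fin k, (1 / (k : ℝ)) • einf (idx j)‖ = 1 / (k : ℝ) := by
  haveI : Nonempty (Fin k) := ⟨⟨0, hk⟩⟩
  rw [comb_norm hk (fun _ => 1 / (k : ℝ)) idx h, ciSup_const, abs_of_nonneg (by positivity)]

theorem diam_einf : Metric.diam (Set.range einf) = 1 := by
  have key : ∀ i j, dist (einf i) (einf j) ≤ 1 := by
    intro i j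
    rw [dist_eq_norm]
    refine lp.norm_le_of_forall_le zero_le_one fun n => ?_
    rw [lp.coeFn_sub, Pi.sub_apply, einf_apply, einf_apply]
    split_ifs <;> norm_num
  apply le_antisymm
  · refine Metric.diam_le_of_forall_dist_le zero_le_one ?_
    rintro _ ⟨i, rfl⟩ _ ⟨j, rfl⟩
    exact key i j
  · have hb : Bornology.IsBounded (Set.range einf) := by
      rw [Metric.isBounded_iff]
      refine ⟨1, ?_⟩
      rintro _ ⟨i, rfl⟩ _ ⟨j, rfl⟩
      exact key i j
    have h1 := Metric.dist_le_diam_of_mem hb (Set.mem_range_self 0) (Set.mem_range_self 1)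
    refine le_trans ?_ h1
    rw [dist_eq_norm]
    have := lp.norm_apply_le_norm (p := ⊤) (by simp) (einf 0 - einf 1) 0
    rw [lp.coeFn_sub, Pi.sub_apply, einf_apply, einf_apply] at this
    simpa using this

theorem phi_einf (k : ℕ) (hk : 1 ≤ k) : Phi (Set.range einf) 0 k = 1 / (k : ℝ) := by
  have hk' : (0 : ℝ) < k := by exact_mod_cast hk
  unfold Phi
  simp only [diam_einf, div_one, sub_zero]
  have hu : ∑ i : Fin k, |(fun _ : Fin k => 1 / (k : ℝ)) i| = 1 := by
    simp [abs_of_pos hk', hk'.ne']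
  haveI : Nonempty {a : Fin k → ℝ // ∑ i, |a i| = 1} := ⟨⟨_, hu⟩⟩
  have hbb : ∀ y : Fin k → Set.range einf, BddBelow (Set.range
      fun a : {a : Fin k → ℝ // ∑ i, |a i| = 1} =>
        ‖∑ i, a.1 i • (y i : lp (fun _ : ℕ => ℝ) ⊤)‖) := by
    intro y
    refine ⟨0, ?_⟩
    rintro _ ⟨a, rfl⟩
    exact norm_nonneg _
  have hup : ∀ y : Fin k → Set.range einf, (⨅ a : {a : Fin k → ℝ // ∑ i, |a i| = 1},
        ‖∑ i, a.1 i • (y i : lp (fun _ : ℕ => ℝ) ⊤)‖) ≤ 1 / (k : ℝ) := by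
    intro y
    choose idx hidx using fun i => (y i).2
    by_cases hinj : Function.Injective idx
    · refine (ciInf_le (hbb y) ⟨_, hu⟩).trans ?_
      simp only [← hidx]
      exact (unif_norm hk idx hinj).le
    · simp only [Function.Injective, not_forall] at hinj
      obtain ⟨p, q, hpq, hne⟩ := hinj
      have hv : ∑ i : Fin k, |(fun i : Fin k => (if i = p then (1 / 2 : ℝ) else 0)
          - (if i = q then (1 / 2 : ℝ) else 0)) i| = 1 := by
        have : ∀ i : Fin k, |(if i = p then (1 / 2 : ℝ) else 0)
          - (if i = q then (1 / 2 : ℝ) else 0)| = (if i = p then (1 / 2 : ℝ) else 0)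
          + (if i = q then (1 / 2 : ℝ) else 0) := by
          intro i
          by_cases h1 : i = p
          · have h2 : i ≠ q := fun h => hne (h1.symm.trans h)
            simp [h1, hne]
          · by_cases h2 : i = q <;> simp [h1, h2, Ne.symm hne]
        simp only [this, Finset.sum_add_distrib, Finset.sum_ite_eq', Finset.mem_univ, if_true]
        norm_num
      refine (ciInf_le (hbb y) ⟨_, hv⟩).trans ?_
      simp only [← hidx, sub_smul, Finset.sum_sub_distrib, ite_smul, zero_smul,
        Finset.sum_ite_eq', Finset.mem_univ, if_true, hpq, sub_self, norm_zero]
      positivity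
  haveI : Nonempty (Fin k → Set.range einf) := ⟨fun _ => ⟨einf 0, 0, rfl⟩⟩
  apply le_antisymm
  · exact ciSup_le hup
  · refine le_trans ?_ (le_ciSup (f := fun y : Fin k → Set.range einf =>
      ⨅ a : {a : Fin k → ℝ // ∑ i, |a i| = 1},
        ‖∑ i, a.1 i • (y i : lp (fun _ : ℕ => ℝ) ⊤)‖) ⟨1 / (k : ℝ), ?_⟩
      (fun i => ⟨einf i, (i : ℕ), rfl⟩))
    · refine le_ciInf fun a => ?_
      have := comb_norm hk a.1 (fun i : Fin k => (i : ℕ)) Fin.val_injective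
      refine (sup_ge hk a.1 a.2).trans this.ge
    · rintro _ ⟨y, rfl⟩
      exact hup y

theorem pres_einf : Pres (Set.range einf) 0 = 0 := by
  unfold Pres
  have hb : BddBelow (Set.range fun k : {k : ℕ // 1 ≤ k} => Phi (Set.range einf) 0 (k : ℕ)) := by
    refine ⟨0, ?_⟩
    rintro _ ⟨k, rfl⟩
    simp only [phi_einf k.1 k.2]
    positivity
  haveI : Nonempty {k : ℕ // 1 ≤ k} := ⟨⟨1, le_rfl⟩⟩
  apply le_antisymm
  · refine le_of_forall_pos_le_add fun ε hε => ?_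
    obtain ⟨n, hn⟩ := exists_nat_one_div_lt hε
    refine (ciInf_le hb ⟨n + 1, by omega⟩).trans ?_
    rw [phi_einf (n + 1) (by omega)]
    push_cast
    linarith
  · refine le_ciInf fun k => ?_
    rw [phi_einf k.1 k.2]
    positivity

theorem stmt12 :
    Metric.diam (Set.range einf) = 1 ∧
    (∀ k : ℕ, 1 ≤ k → Phi (Set.range einf) 0 k = 1 / (k : ℝ)) ∧
    Pres (Set.range einf) 0 = 0 ∧
    (∀ k : ℕ, 1 ≤ k → ∀ a : Fin k → ℝ, (∑ j, |a j|) = 1 →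
      ∀ idx : Fin k → ℕ, Function.Injective idx →
        ‖∑ j, a j • einf (idx j)‖ = (⨆ j, |a j|) ∧ 1 / (k : ℝ) ≤ ⨆ j, |a j|) ∧
    (∀ k : ℕ, 1 ≤ k → ∀ idx : Fin k → ℕ, Function.Injective idx →
      ‖∑ j : Fin k, (1 / (k : ℝ)) • einf (idx j)‖ = 1 / (k : ℝ)) := 
  ⟨diam_einf, phi_einf, pres_einf,
    fun _ hk a ha idx h => ⟨comb_norm hk a idx h, sup_ge hk a ha⟩,
    fun _ hk idx h => unif_norm hk idx h⟩
end

section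
/- Let X be a real inner product space, m ≥ 2 an integer, and v₁, …, v_m ∈ X distinct unit vectors with mutual coherence μ := max_{i≠j} |⟨v_i, v_j⟩| satisfying μ(m−1) < 1. Then: (a) ‖v_i − v_j‖ ≤ √(2(1+μ)) for all i ≠ j; (b) every a ∈ ℝ^m with |a₁| + ⋯ + |a_m| = 1 satisfies ‖Σ_{i=1}^m a_i v_i‖ ≥ √((1 − μ(m−1))/m); and (c) with C₁ = {v₁, …, v_m} and x∞ = 0, for every integer k with 1 ≤ k ≤ m one has Φ_k(C₁, 0) ≥ √(1 − μ(m−1)) / (√m · √(2(1+μ))). -/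
open scoped RealInnerProductSpace

lemma aux_lower {X : Type*} [NormedAddCommGroup X] [InnerProductSpace ℝ X]
    (k m : ℕ) (hk : 1 ≤ k) (hkm : k ≤ m) (w : Fin k → X) (hunit : ∀ i, ‖w i‖ = 1)
    (μ : ℝ) (h0 : 0 ≤ μ) (hμ : ∀ i j, i ≠ j → |⟪w i, w j⟫| ≤ μ)
    (a : Fin k → ℝ) (ha : (∑ i, |a i|) = 1) :
    Real.sqrt ((1 - μ * ((m : ℝ) - 1)) / m) ≤ ‖∑ i, a i • w i‖ := by
  apply Real.sqrt_le_left (norm_nonneg _) |>.mpr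
  have hk0 : (0 : ℝ) < k := by exact_mod_cast hk
  have hkm' : (k : ℝ) ≤ m := by exact_mod_cast hkm
  have hm0 : (0 : ℝ) < m := lt_of_lt_of_le hk0 hkm'
  have e : ‖∑ i, a i • w i‖ ^ 2 = ∑ i, ∑ j, a i * a j * ⟪w i, w j⟫ := by
    rw [← real_inner_self_eq_norm_sq, sum_inner]
    refine Finset.sum_congr rfl fun i _ => ?_
    rw [inner_sum]
    refine Finset.sum_congr rfl fun j _ => ?_
    rw [real_inner_smul_left, real_inner_smul_right]; ring
  have h1 : ∑ i, ∑ j, ((if i = j then (1 + μ) * |a i| ^ 2 else 0) - μ * (|a i| * |a j|))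
      ≤ ∑ i, ∑ j, a i * a j * ⟪w i, w j⟫ := by
    refine Finset.sum_le_sum fun i _ => Finset.sum_le_sum fun j _ => ?_
    split_ifs with h
    · subst h
      rw [real_inner_self_eq_norm_sq, hunit, ← abs_mul_abs_self (a i)]
      nlinarith
    · have h2 : |a i * a j * ⟪w i, w j⟫| ≤ |a i| * |a j| * μ := by
        rw [abs_mul, abs_mul]
        exact mul_le_mul_of_nonneg_left (hμ i j h) (by positivity)
      have := neg_abs_le (a i * a j * ⟪w i, w j⟫)
      linarith
  have h2 : ∑ i, ∑ j, ((if i = j then (1 + μ) * |a i| ^ 2 else 0) - μ * (|a i| * |a j|))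
      = (1 + μ) * ∑ i, |a i| ^ 2 - μ := by
    simp only [Finset.sum_sub_distrib, ← Finset.mul_sum, ha]
    simp [← Finset.mul_sum, ha]
  have h3 : 1 ≤ (k : ℝ) * ∑ i, |a i| ^ 2 := by
    have := sq_sum_le_card_mul_sum_sq (s := Finset.univ) (f := fun i => |a i|)
    simpa only [ha, Finset.card_univ, Fintype.card_fin, one_pow] using this
  have hS : 0 ≤ ∑ i, |a i| ^ 2 := Finset.sum_nonneg fun i _ => by positivity
  rw [e]
  refine le_trans ?_ (h2 ▸ h1)
  rw [div_le_iff₀ hm0]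
  have h4 : 1 ≤ (m : ℝ) * ∑ i, |a i| ^ 2 := h3.trans (mul_le_mul_of_nonneg_right hkm' hS)
  nlinarith

theorem stmt16 {X : Type*} [NormedAddCommGroup X] [InnerProductSpace ℝ X]
    (m : ℕ) (hm : 2 ≤ m) (v : Fin m → X) (hunit : ∀ i, ‖v i‖ = 1)
    (hdist : Function.Injective v) (μ : ℝ)
    (hμ : IsGreatest {t : ℝ | ∃ i j : Fin m, i ≠ j ∧ t = |⟪v i, v j⟫|} μ)
    (hsmall : μ * ((m : ℝ) - 1) < 1) :
    (∀ i j : Fin m, i ≠ j → ‖v i - v j‖ ≤ Real.sqrt (2 * (1 + μ))) ∧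
    (∀ a : Fin m → ℝ, (∑ i, |a i|) = 1 →
      Real.sqrt ((1 - μ * ((m : ℝ) - 1)) / m) ≤ ‖∑ i, a i • v i‖) ∧
    (∀ k : ℕ, 1 ≤ k → k ≤ m →
      Real.sqrt (1 - μ * ((m : ℝ) - 1)) / (Real.sqrt m * Real.sqrt (2 * (1 + μ))) ≤
        Phi (Set.range v) 0 k) := by
  obtain ⟨⟨i₀, j₀, hij₀, hμe⟩, hub⟩ := hμ
  have h0 : 0 ≤ μ := hμe ▸ abs_nonneg _
  have hc : ∀ i j, i ≠ j → |⟪v i, v j⟫| ≤ μ := fun i j h => hub ⟨i, j, h, rfl⟩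
  have hA : ∀ i j : Fin m, i ≠ j → ‖v i - v j‖ ≤ Real.sqrt (2 * (1 + μ)) := by
    intro i j h
    apply Real.le_sqrt_of_sq_le
    rw [norm_sub_sq_real, hunit, hunit]
    have := (abs_le.mp (hc i j h)).1
    linarith
  refine ⟨hA, fun a ha => aux_lower m m (by omega) le_rfl v hunit μ h0 hc a ha, ?_⟩
  intro k hk hkm
  have hfin : (Set.range v).Finite := Set.finite_range v
  have hDpos : 0 < Metric.diam (Set.range v) := by
    refine lt_of_lt_of_le (dist_pos.mpr (hdist.ne hij₀))
      (Metric.dist_le_diam_of_mem hfin.isBounded ⟨i₀, rfl⟩ ⟨j₀, rfl⟩)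
  have hDle : Metric.diam (Set.range v) ≤ Real.sqrt (2 * (1 + μ)) := by
    refine Metric.diam_le_of_forall_dist_le (Real.sqrt_nonneg _) ?_
    rintro _ ⟨i, rfl⟩ _ ⟨j, rfl⟩
    by_cases h : i = j
    · subst h; simp
    · rw [dist_eq_norm]; exact hA i j h
  haveI : Finite (Set.range v) := hfin
  unfold Phi
  refine le_ciSup_of_le (Set.finite_range _).bddAbove
    (fun i : Fin k => (⟨v (Fin.castLE hkm i), ⟨_, rfl⟩⟩ : Set.range v)) ?_
  haveI : Nonempty {a : Fin k → ℝ // ∑ i, |a i| = 1} := by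
    refine ⟨⟨fun i => if i = ⟨0, hk⟩ then 1 else 0, ?_⟩⟩
    simp [apply_ite abs]
  refine le_ciInf fun a => ?_
  have hl := aux_lower k m hk hkm (fun i => v (Fin.castLE hkm i)) (fun i => hunit _) μ h0
    (fun i j h => hc _ _ (fun h' => h (Fin.castLE_injective hkm h'))) a.1 a.2
  have e : ∑ i, (a.1 i / Metric.diam (Set.range v)) • (v (Fin.castLE hkm i) - 0)
      = (Metric.diam (Set.range v))⁻¹ • ∑ i, a.1 i • v (Fin.castLE hkm i) := by
    rw [Finset.smul_sum]
    refine Finset.sum_congr rfl fun i _ => ?_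
    rw [sub_zero, smul_smul]; congr 1; ring
  simp only
  rw [e, norm_smul, norm_inv, Real.norm_of_nonneg hDpos.le, ← div_div,
    ← Real.sqrt_div (by linarith), inv_mul_eq_div]
  exact div_le_div₀ (norm_nonneg _) hl hDpos hDle
end

section
/- Let X be a uniformly convex real Banach space and let C ⊆ X be a nonempty closed convex bounded subset. Then every nonexpansive map T : C → C has a fixed point, i.e. there exists x ∈ C with T x = x. -/
theorem stmt19 {X : Type*} [NormedAddCommGroup X] [NormedSpace ℝ X]
    [UniformConvexSpace X] [CompleteSpace X]
    (C : Set X) (hne : C.Nonempty) (hcl : IsClosed C) (hconv : Convex ℝ C)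
    (hbdd : Bornology.IsBounded C)
    (T : X → X) (hmaps : Set.MapsTo T C C)
    (hnonexp : ∀ x ∈ C, ∀ y ∈ C, ‖T x - T y‖ ≤ ‖x - y‖) :
    ∃ x ∈ C, T x = x := by
  obtain ⟨x0, hx0⟩ := hne
  obtain ⟨x, hxC, hxs⟩ : ∃ x : ℕ → X, (∀ n, x n ∈ C) ∧ ∀ n, x (n + 1) = T (x n) := by
    refine ⟨fun n => T^[n] x0, fun n => hmaps.iterate n hx0, fun n => ?_⟩
    exact Function.iterate_succ_apply' T n x0
  -- `P y s`: the orbit is eventually within `s` of `y`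
  let P : X → ℝ → Prop := fun y s => ∃ N, ∀ n, N ≤ n → ‖x n - y‖ ≤ s
  have hPT : ∀ y ∈ C, ∀ s, P y s → P (T y) s := by
    rintro y hy s ⟨N, hN⟩
    refine ⟨N + 1, fun n hn => ?_⟩
    obtain ⟨m, rfl⟩ : ∃ m, n = m + 1 := ⟨n - 1, by omega⟩
    rw [hxs]
    exact (hnonexp _ (hxC m) _ hy).trans (hN m (by omega))
  let S : Set ℝ := {s | ∃ y ∈ C, P y s}
  have hS0 : ∀ s ∈ S, 0 ≤ s := by
    rintro s ⟨y, -, N, hN⟩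
    exact (norm_nonneg _).trans (hN N le_rfl)
  have hSne : S.Nonempty := by
    obtain ⟨M, hM⟩ := Metric.isBounded_iff.1 hbdd
    refine ⟨M, x0, hx0, 0, fun n _ => ?_⟩
    rw [← dist_eq_norm]
    exact hM (hxC n) hx0
  have hSb : BddBelow S := ⟨0, hS0⟩
  set r := sInf S with hr
  have hr0 : 0 ≤ r := le_csInf hSne hS0
  have hmono : ∀ y s t, s ≤ t → P y s → P y t := by
    rintro y s t hst ⟨N, hN⟩
    exact ⟨N, fun n hn => (hN n hn).trans hst⟩
  have hA : ∀ η > 0, ∃ y ∈ C, P y (r + η) := by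
    intro η hη
    obtain ⟨s, ⟨y, hy, hP⟩, hs⟩ := exists_lt_of_csInf_lt hSne (show sInf S < r + η by linarith)
    exact ⟨y, hy, hmono _ _ _ hs.le hP⟩
  have hdiam : ∀ ε > 0, ∃ η > 0, ∀ y ∈ C, ∀ z ∈ C, P y (r + η) → P z (r + η) →
      ‖y - z‖ < ε := by
    intro ε hε
    rcases hr0.eq_or_lt with h0 | hpos
    · refine ⟨ε / 3, by positivity, ?_⟩
      rintro y hy z hz ⟨N, hN⟩ ⟨M, hM⟩
      have h1 := hN (max N M) (le_max_left _ _)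
      have h2 := hM (max N M) (le_max_right _ _)
      have h3 : ‖y - z‖ ≤ ‖x (max N M) - z‖ + ‖x (max N M) - y‖ := by
        have := norm_sub_le (x (max N M) - z) (x (max N M) - y)
        rwa [sub_sub_sub_cancel_left] at this
      linarith
    · obtain ⟨δ, hδ, h⟩ := exists_forall_closed_ball_dist_add_le_two_sub X
        (show 0 < ε / (r + 1) by positivity)
      refine ⟨min 1 (r * δ / 2), by positivity, ?_⟩
      have hη1 := min_le_left 1 (r * δ / 2)
      have hη2 := min_le_right 1 (r * δ / 2)
      have hη0 : 0 < min 1 (r * δ / 2) := by positivity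
      set η := min 1 (r * δ / 2)
      rintro y hy z hz ⟨N, hN⟩ ⟨M, hM⟩
      by_contra! hyz
      have hR : 0 < r + η := by linarith
      have hmem : (r + η) * (1 - δ / 2) ∈ S := by
        refine ⟨(1 / 2 : ℝ) • y + (1 / 2 : ℝ) • z,
          hconv hy hz (by norm_num) (by norm_num) (by norm_num), max N M, fun n hn => ?_⟩
        have h1 := hN n ((le_max_left _ _).trans hn)
        have h2 := hM n ((le_max_right _ _).trans hn)
        have hn' : ∀ v : X, ‖(r + η)⁻¹ • v‖ = ‖v‖ / (r + η) := fun v => by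
          rw [norm_smul_of_nonneg (inv_nonneg.2 hR.le), div_eq_inv_mul]
        have h3 := @h ((r + η)⁻¹ • (x n - y)) (by rw [hn']; exact (div_le_one hR).2 h1)
          ((r + η)⁻¹ • (x n - z)) (by rw [hn']; exact (div_le_one hR).2 h2) (by
            rw [← smul_sub, hn', sub_sub_sub_cancel_left, norm_sub_rev]
            gcongr)
        rw [← smul_add, hn', div_le_iff₀ hR] at h3
        have h4 : x n - ((1 / 2 : ℝ) • y + (1 / 2 : ℝ) • z)
            = (1 / 2 : ℝ) • ((x n - y) + (x n - z)) := by module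
        rw [h4, norm_smul_of_nonneg (by norm_num)]
        linarith
      have := csInf_le hSb hmem
      nlinarith [mul_pos hη0 hδ]
  choose u huC huP using fun k : ℕ => hA (1 / ((k : ℝ) + 1)) (by positivity)
  have hsmall : ∀ η > 0, ∃ K, ∀ k, K ≤ k → P (u k) (r + η) := by
    intro η hη
    obtain ⟨K, hK⟩ := exists_nat_one_div_lt hη
    refine ⟨K, fun k hk => hmono _ _ _ ?_ (huP k)⟩
    have : 1 / ((k : ℝ) + 1) ≤ 1 / ((K : ℝ) + 1) := by gcongr
    linarith
  have hcau : CauchySeq u := by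
    refine Metric.cauchySeq_iff.2 fun ε hε => ?_
    obtain ⟨η, hη, h⟩ := hdiam ε hε
    obtain ⟨K, hK⟩ := hsmall η hη
    refine ⟨K, fun m hm n hn => ?_⟩
    rw [dist_eq_norm]
    exact h _ (huC m) _ (huC n) (hK m hm) (hK n hn)
  obtain ⟨y, hy⟩ := cauchySeq_tendsto_of_complete hcau
  have hyC : y ∈ C := hcl.mem_of_tendsto hy (Filter.Eventually.of_forall huC)
  have hyP : ∀ η > 0, P y (r + η) := by
    intro η hη
    obtain ⟨K, hK⟩ := hsmall (η / 2) (by positivity)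
    obtain ⟨L, hL⟩ := Metric.tendsto_atTop.1 hy (η / 2) (by positivity)
    obtain ⟨N, hN⟩ := hK (max K L) (le_max_left _ _)
    have h2 := hL (max K L) (le_max_right _ _)
    rw [dist_eq_norm] at h2
    refine ⟨N, fun n hn => ?_⟩
    have h1 := hN n hn
    have h3 := norm_add_le (x n - u (max K L)) (u (max K L) - y)
    rw [sub_add_sub_cancel] at h3
    linarith
  refine ⟨y, hyC, ?_⟩
  by_contra hne
  obtain ⟨η, hη, h⟩ := hdiam ‖T y - y‖ (norm_sub_pos_iff.2 hne)
  exact lt_irrefl _ (h _ (hmaps hyC) _ hyC (hPT y hyC _ (hyP η hη)) (hyP η hη))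
end
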